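/- For every deterministic synchronous two-client protocol in the WithDelegation append model that satisfies liveness (in the crash-free execution both r_A is eventually appended to DLO_A and r_B is eventually appended to DLO_B), there exists a crash pattern in which both clients have finite crash times such that in the resulting execution exactly one of the two records is ever appended; hence safety is violated and no such protocol solves Collaborative 2-AtomicAppends when both clients may crash. -/

import Mathlib

/-!
STATEMENT 5. For every deterministic synchronous two-client protocol in the
WithDelegation append model that satisfies liveness (in the crash-free execution both r_A
is eventually appended to DLO_A and r_B is eventually appended to DLO_B), there exists a
crash pattern in which both clients have finite crash times such that in the resulting
execution exactly one of the two records is ever appended; hence safety is violated and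
no such protocol solves Collaborative 2-AtomicAppends when both clients may crash.

Modeling: clients proceed in lockstep rounds; in each round a non-crashed client performs
at most one action: stay idle, send a message (received by the other client at the start
of the next round), append its own record r_X to DLO_X, or append the other client's
record to the other client's ledger (both appends take effect in that round).  A
deterministic protocol maps a client's local history — the list whose `i`-th entry is the
(optional) message received at the start of round `i+1`, i.e. sent by the other client in
round `i` — to its action.  WithDelegation: the predicate `carries m Y` states that
message `m` carries the record of client `Y`; a legal protocol may prescribe the append of
the other client's record only when some previously received message carried that record.
A crash pattern assigns each client a crash time in `ℕ∞ = ℕ ∪ {∞}`; a client performs no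
actions from its crash round onward.  Appends are idempotent, so "r_X is ever in DLO_X"
is equivalent to: in some round X appends its own record, or the other client appends
X's record.
-/

/-- The two clients. -/
inductive Client where
  | A
  | B
deriving DecidableEq

/-- The other client. -/
def Client.other : Client → Client
  | .A => .B
  | .B => .A

/-- Actions available in a round under WithDelegation: idle, send a message, append
one's own record to one's own ledger, or append the other client's record to the
other client's ledger. -/
inductive WDAct (M : Type) where
  | idle : WDAct M
  | send : M → WDAct M
  | appendOwn : WDAct M
  | appendOther : WDAct M

/-- WithDelegation legality: a client may append the other client's record only in
rounds after it has received that record in a message, i.e. only when its local history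
contains a message carrying the other client's record. -/
def WithDelegationLegal {M : Type} (carries : M → Client → Prop)
    (P : Client → List (Option M) → WDAct M) : Prop :=
  ∀ (X : Client) (h : List (Option M)), P X h = WDAct.appendOther →
    ∃ m : M, some m ∈ h ∧ carries m X.other

/-- The message (if any) that client `Y`, with local history `h` and crash time `cr Y`,
sends in round `t`. -/
def sentMsg {M : Type} (P : Client → List (Option M) → WDAct M) (cr : Client → ℕ∞)
    (h : List (Option M)) (t : ℕ) (Y : Client) : Option M :=
  if (t : ℕ∞) < cr Y then
    match P Y h with
    | WDAct.send m => some m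
    | _ => none
  else none

/-- The local history of each client at the beginning of round `t` in the (deterministic)
execution of protocol `P` under crash pattern `cr`: the list of messages received so far. -/
def histories {M : Type} (P : Client → List (Option M) → WDAct M) (cr : Client → ℕ∞) :
    ℕ → Client → List (Option M)
  | 0, _ => []
  | t + 1, X =>
      histories P cr t X ++ [sentMsg P cr (histories P cr t X.other) t X.other]

/-- Record r_X is ever appended to DLO_X in the execution of `P` under `cr`: either
client `X` appends its own record in some round, or the other client appends `X`'s
record in some round. -/
def recordAppended {M : Type} (P : Client → List (Option M) → WDAct M)
    (cr : Client → ℕ∞) (X : Client) : Prop :=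
  (∃ t : ℕ, (t : ℕ∞) < cr X ∧ P X (histories P cr t X) = WDAct.appendOwn) ∨
  (∃ t : ℕ, (t : ℕ∞) < cr X.other ∧
    P X.other (histories P cr t X.other) = WDAct.appendOther)

/-- If no client crashes before round `t`, histories up to round `t` are crash-free. -/
theorem histories_eq_crash_free {M : Type} (P : Client → List (Option M) → WDAct M)
    (cr : Client → ℕ∞) (t : ℕ) (hcr : ∀ Y, (t : ℕ∞) ≤ cr Y) :
    ∀ s : ℕ, s ≤ t → ∀ Y, histories P cr s Y = histories P (fun _ => (⊤ : ℕ∞)) s Y := by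
  intro s
  induction s with
  | zero => intro _ Y; rfl
  | succ s ih =>
    intro hs Y
    have h1 : (s : ℕ∞) < cr Y.other :=
      lt_of_lt_of_le (by exact_mod_cast hs) (hcr Y.other)
    have h2 : (s : ℕ∞) < ⊤ := ENat.coe_lt_top s
    simp only [histories, ih (by omega), sentMsg, h1, h2, if_true]

theorem with_delegation_two_crashes_impossibility {M : Type}
    (carries : M → Client → Prop)
    (P : Client → List (Option M) → WDAct M)
    (h_legal : WithDelegationLegal carries P)
    -- liveness in the crash-free execution: both records are eventually appended
    (h_live : recordAppended P (fun _ => (⊤ : ℕ∞)) Client.A ∧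
              recordAppended P (fun _ => (⊤ : ℕ∞)) Client.B) :
    ∃ cr : Client → ℕ∞,
      -- both clients have finite crash times
      (cr Client.A ≠ ⊤ ∧ cr Client.B ≠ ⊤) ∧
      -- in the resulting execution exactly one of the two records is ever appended
      ((recordAppended P cr Client.A ∧ ¬ recordAppended P cr Client.B) ∨
       (¬ recordAppended P cr Client.A ∧ recordAppended P cr Client.B)) := by
  classical
  let T : Client → ℕ∞ := fun _ => ⊤
  let Q : ℕ → Prop := fun t => ∃ X, P X (histories P T t X) = WDAct.appendOwn ∨
    P X (histories P T t X) = WDAct.appendOther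
  have hQ : ∃ t, Q t := by
    rcases h_live.1 with ⟨t, _, h⟩ | ⟨t, _, h⟩
    · exact ⟨t, _, Or.inl h⟩
    · exact ⟨t, _, Or.inr h⟩
  obtain ⟨t, ⟨X, hX⟩, hmin⟩ : ∃ t, Q t ∧ ∀ s, s < t → ¬ Q s :=
    ⟨Nat.find hQ, Nat.find_spec hQ, fun s hs => Nat.find_min hQ hs⟩
  let cr : Client → ℕ∞ := fun Y => if Y = X then ((t + 1 : ℕ) : ℕ∞) else (t : ℕ∞)
  have hge : ∀ Y, (t : ℕ∞) ≤ cr Y := by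
    intro Y
    by_cases h : Y = X
    · simp only [cr, h, if_true]; exact_mod_cast Nat.le_succ t
    · simp [cr, h]
  have hh := histories_eq_crash_free P cr t hge
  have hXlt : (t : ℕ∞) < cr X := by
    simp only [cr, if_true]; exact_mod_cast Nat.lt_succ_self t
  -- the only append performed is that of `X` in round `t`
  have key : ∀ (s : ℕ) (Y : Client), (s : ℕ∞) < cr Y →
      (P Y (histories P cr s Y) = WDAct.appendOwn ∨
        P Y (histories P cr s Y) = WDAct.appendOther) → s = t ∧ Y = X := by
    intro s Y hs hP
    have hst : s ≤ t := by
      by_cases h : Y = X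
      · simp only [cr, h, if_true] at hs
        have : s < t + 1 := by exact_mod_cast hs
        omega
      · simp only [cr, h, if_false] at hs
        have : s < t := by exact_mod_cast hs
        omega
    rw [hh s hst Y] at hP
    have hEq : s = t := by
      by_contra hne
      exact hmin s (by omega) ⟨Y, hP⟩
    refine ⟨hEq, ?_⟩
    by_contra h
    simp only [cr, h, if_false] at hs
    have : s < t := by exact_mod_cast hs
    omega
  have hchar : ∀ Z, recordAppended P cr Z ↔
      (Z = X ∧ P X (histories P cr t X) = WDAct.appendOwn) ∨
      (Z.other = X ∧ P X (histories P cr t X) = WDAct.appendOther) := by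
    intro Z
    constructor
    · rintro (⟨s, hs, h⟩ | ⟨s, hs, h⟩)
      · obtain ⟨rfl, hz⟩ := key s Z hs (Or.inl h)
        exact Or.inl ⟨hz, hz ▸ h⟩
      · obtain ⟨rfl, hz⟩ := key s Z.other hs (Or.inr h)
        exact Or.inr ⟨hz, hz ▸ h⟩
    · rintro (⟨hz, h⟩ | ⟨hz, h⟩)
      · exact Or.inl ⟨t, by rw [hz]; exact hXlt, by rw [hz]; exact h⟩
      · exact Or.inr ⟨t, by rw [hz]; exact hXlt, by rw [hz]; exact h⟩
  have hfin : ∀ Y, cr Y ≠ ⊤ := by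
    intro Y
    by_cases h : Y = X
    · simp only [cr, h, if_true]; exact ENat.coe_ne_top _
    · simp only [cr, h, if_false]; exact ENat.coe_ne_top _
  refine ⟨cr, ⟨hfin _, hfin _⟩, ?_⟩
  rw [hchar, hchar]
  have hX' : P X (histories P cr t X) = WDAct.appendOwn ∨
      P X (histories P cr t X) = WDAct.appendOther := by
    rw [hh t le_rfl X]; exact hX
  clear_value cr
  rcases hX' with h | h <;> rw [h] <;> cases X <;> simp [Client.other]
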